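/- Let G be a finitely generated nilpotent group and M a submonoid of G. If MG' is a finite-index subgroup of G, where G' = [G,G], then M is a finite-index subgroup of G. -/

import Mathlib

open scoped Pointwise
open Subgroup
open scoped commutatorElement
theorem comm_part {A : Type*} [CommGroup A] [Group.FG A] (S : Submonoid A) (X : Set A)
    (hX : closure X = ⊤)
    (h : ∀ z ∈ X, ∃ u ∈ S, ∃ n : ℕ, 0 < n ∧ ∀ k : ℤ, ∃ m : ℕ, 0 < m ∧ ((z ^ n) ^ k * u) ^ m ∈ S) :
    ∀ z : A, ∃ m : ℕ, 0 < m ∧ z ^ m ∈ S := by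
  let E : S → Subgroup A := fun u =>
    { carrier := {z | ∀ k : ℤ, ∃ m : ℕ, 0 < m ∧ (z ^ k * u) ^ m ∈ S}
      one_mem' := fun k => ⟨1, one_pos, by simp⟩
      inv_mem' := by
        intro z hz k
        obtain ⟨m, hm, h⟩ := hz (-k)
        exact ⟨m, hm, by simpa using h⟩
      mul_mem' := by
        intro a b ha hb k
        obtain ⟨m, hm, h⟩ := ha (2 * k)
        obtain ⟨n, hn, h'⟩ := hb (2 * k)
        refine ⟨2 * (m * n), by positivity, ?_⟩
        have := S.mul_mem (S.pow_mem h n) (S.pow_mem h' m)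
        convert this using 1
        rw [← pow_mul, ← pow_mul, mul_comm n m, ← mul_pow, pow_mul]
        congr 1
        rw [mul_comm 2 k, zpow_mul, zpow_mul, mul_zpow]
        rw [zpow_ofNat, zpow_ofNat]
        simp only [pow_two]
        simp only [mul_comm, mul_left_comm, mul_assoc] }
  have hE : ∀ (u : S) (z : A), z ∈ E u ↔ ∀ k : ℤ, ∃ m : ℕ, 0 < m ∧ (z ^ k * u) ^ m ∈ S :=
    fun _ _ => Iff.rfl
  have hroot : ∀ (u : S) (z : A) (n : ℕ), 0 < n → z ^ n ∈ E u → z ∈ E u := by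
    intro u z n hn hz k
    obtain ⟨m, hm, h⟩ := hz k
    refine ⟨n * m, by positivity, ?_⟩
    have := S.mul_mem h (S.pow_mem (S.pow_mem u.2 (n - 1)) m)
    convert this using 1
    rw [← mul_pow, pow_mul]
    congr 1
    rw [mul_assoc, ← pow_succ', Nat.sub_add_cancel hn, mul_pow]
    congr 1
    rw [← zpow_natCast, ← zpow_natCast, zpow_comm]
  have hmono : ∀ u v : S, E u ≤ E (u * v) := by
    intro u v z hz k
    obtain ⟨m, hm, h⟩ := hz k
    refine ⟨m, hm, ?_⟩
    have := S.mul_mem h (S.pow_mem v.2 m)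
    rwa [← mul_pow, mul_assoc] at this
  have hdir : Directed (· ≤ ·) E := fun u v =>
    ⟨u * v, hmono u v, by rw [mul_comm]; exact hmono v u⟩
  have htop : ⨆ u, E u = ⊤ := by
    rw [eq_top_iff, ← hX, closure_le]
    intro z hz
    obtain ⟨u, hu, n, hn, h⟩ := h z hz
    exact (le_iSup E ⟨u, hu⟩) (hroot _ _ n hn h)
  obtain ⟨F, hF⟩ := (Group.fg_iff_subgroup_fg (H := (⊤ : Subgroup A))).mp
    (Group.fg_iff_subgroup_fg _ |>.mpr (Group.fg_def.mp inferInstance))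
  have hFu : ∀ F : Finset A, ∃ U : S, (F : Set A) ⊆ E U := by
    intro F
    classical
    induction F using Finset.induction_on with
    | empty => exact ⟨1, by simp⟩
    | insert a F _ ih =>
      obtain ⟨U, hU⟩ := ih
      have ha : a ∈ ⨆ u, E u := htop ▸ mem_top a
      rw [mem_iSup_of_directed hdir] at ha
      obtain ⟨v, hv⟩ := ha
      obtain ⟨w, h1, h2⟩ := hdir U v
      refine ⟨w, ?_⟩
      rw [Finset.coe_insert, Set.insert_subset_iff]
      exact ⟨h2 hv, hU.trans h1⟩
  obtain ⟨U, hU⟩ := hFu F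
  have hall : ∀ z, z ∈ E U := by
    intro z
    have : E U = ⊤ := by rw [eq_top_iff, ← hF, closure_le]; exact hU
    rw [this]; exact mem_top z
  obtain ⟨m, hm, hm'⟩ := (hE _ _).1 (hall U) (-2)
  intro z
  obtain ⟨n, hn, hn'⟩ := (hE _ _).1 (hall z) 1
  refine ⟨n * m, by positivity, ?_⟩
  have := S.mul_mem (S.pow_mem hn' m) (S.pow_mem hm' n)
  convert this using 1
  rw [← pow_mul, ← pow_mul, mul_comm m n, ← mul_pow]
  congr 1
  group

theorem finite_part {A : Type*} [CommGroup A] [Group.FG A] (S : Subgroup A)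
    (h : ∀ z : A, ∃ m : ℕ, 0 < m ∧ z ^ m ∈ S) : S.FiniteIndex := by
  have : Finite (A ⧸ S) := by
    apply CommGroup.finite_of_fg_isMulTorsion
    intro x
    obtain ⟨z, rfl⟩ := QuotientGroup.mk_surjective x
    obtain ⟨m, hm, h⟩ := h z
    rw [isOfFinOrder_iff_pow_eq_one]
    refine ⟨m, hm, ?_⟩
    rw [← QuotientGroup.mk_pow]
    exact (QuotientGroup.eq_one_iff _).2 h
  exact finiteIndex_of_finite_quotient

theorem comm_pow_left {G : Type*} [Group G] (a b c : G) (hc : ∀ g, Commute c g)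
    (h : a * b = c * (b * a)) (k : ℕ) : a ^ k * b = c ^ k * (b * a ^ k) := by
  induction k with
  | zero => simp
  | succ k ih =>
    have := ((hc b).pow_left k).eq
    have h2 := ((hc a).pow_left k).eq
    rw [pow_succ', mul_assoc, ih, ← mul_assoc, ← h2, mul_assoc, ← mul_assoc a b, h,
      pow_succ]
    simp only [mul_assoc]

theorem comm_pow {G : Type*} [Group G] (a b c : G) (hc : ∀ g, Commute c g)
    (h : a * b = c * (b * a)) (k l : ℕ) : a ^ k * b ^ l = c ^ (k * l) * (b ^ l * a ^ k) := by
  have h1 := comm_pow_left a b c hc h k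
  have h2 : b * a ^ k = (c ^ k)⁻¹ * (a ^ k * b) := by rw [h1]; group
  have h3 := comm_pow_left b (a ^ k) _ (fun g => ((hc g).pow_left k).inv_left) h2 l
  rw [h3, inv_pow, ← pow_mul]
  group

theorem lcs_fg {G : Type*} [Group G] [Group.FG G] (n : ℕ) :
    ∃ F : Set G, F.Finite ∧ F ⊆ (⊤ : Subgroup G).lowerCentralSeries n ∧
      (⊤ : Subgroup G).lowerCentralSeries n ≤
        closure F ⊔ (⊤ : Subgroup G).lowerCentralSeries (n + 1) := by
  obtain ⟨T, hT⟩ := Group.fg_def.mp (inferInstance : Group.FG G)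
  induction n with
  | zero => exact ⟨T, T.finite_toSet, fun _ _ => mem_top _, by rw [hT]; simp⟩
  | succ n ih =>
    obtain ⟨F, hF, hFs, hFc⟩ := ih
    set g0 := (⊤ : Subgroup G).lowerCentralSeries n with hg0
    set g1 := (⊤ : Subgroup G).lowerCentralSeries (n + 1) with hg1
    set g2 := (⊤ : Subgroup G).lowerCentralSeries (n + 1 + 1) with hg2
    have c01 : ∀ x ∈ g0, ∀ y, ⁅x, y⁆ ∈ g1 := fun x hx y =>
      commutator_mem_commutator hx (mem_top y)
    have c12 : ∀ x ∈ g1, ∀ y, ⁅x, y⁆ ∈ g2 := fun x hx y =>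
      commutator_mem_commutator hx (mem_top y)
    have h10 : g1 ≤ g0 := Subgroup.lowerCentralSeries_antitone _ (Nat.le_succ n)
    refine ⟨Set.image2 (fun x y => ⁅x, y⁆) F T, hF.image2 _ T.finite_toSet, ?_, ?_⟩
    · rintro _ ⟨x, hx, y, _, rfl⟩
      exact c01 x (hFs hx) y
    set H := closure (Set.image2 (fun x y => ⁅x, y⁆) F (T : Set G)) ⊔ g2 with hH
    have h2H : g2 ≤ H := le_sup_right
    have conj : ∀ c ∈ g1, c ∈ H → ∀ g : G, g * c * g⁻¹ ∈ H := by
      intro c hc hcH g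
      have : g * c * g⁻¹ = ⁅c, g⁆⁻¹ * c := by simp [commutatorElement_def, mul_assoc]
      rw [this]
      exact H.mul_mem (H.inv_mem (h2H (c12 c hc g))) hcH
    have s1 : ∀ t ∈ T, ∀ x ∈ g0, ⁅x, t⁆ ∈ H := by
      intro t ht
      let P : Subgroup G :=
        { carrier := {x | x ∈ g0 ∧ ⁅x, t⁆ ∈ H}
          one_mem' := ⟨g0.one_mem, by simp⟩
          mul_mem' := by
            rintro x y ⟨hx, hx'⟩ ⟨hy, hy'⟩
            refine ⟨g0.mul_mem hx hy, ?_⟩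
            have : ⁅x * y, t⁆ = (x * ⁅y, t⁆ * x⁻¹) * ⁅x, t⁆ := by
              simp [commutatorElement_def, mul_assoc]
            rw [this]
            exact H.mul_mem (conj _ (c01 y hy t) hy' x) hx'
          inv_mem' := by
            rintro x ⟨hx, hx'⟩
            refine ⟨g0.inv_mem hx, ?_⟩
            have : ⁅x⁻¹, t⁆ = (x⁻¹ * ⁅x, t⁆⁻¹ * x⁻¹⁻¹) := by
              simp [commutatorElement_def, mul_assoc]
            rw [this]
            exact conj _ (g1.inv_mem (c01 x hx t)) (H.inv_mem hx') _ }
      have hP : g0 ≤ P := by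
        refine hFc.trans (sup_le ?_ ?_)
        · rw [closure_le]
          exact fun x hx => ⟨hFs hx, (le_sup_left : _ ≤ H) (subset_closure ⟨x, hx, t, ht, rfl⟩)⟩
        · exact fun x hx => ⟨h10 hx, h2H (c12 x hx t)⟩
      exact fun x hx => (hP hx).2
    have s2 : ∀ x ∈ g0, ∀ g, ⁅x, g⁆ ∈ H := by
      intro x hx
      let P : Subgroup G :=
        { carrier := {g | ⁅x, g⁆ ∈ H}
          one_mem' := by simp
          mul_mem' := by
            intro g k hg hk
            have : ⁅x, g * k⁆ = ⁅x, g⁆ * (g * ⁅x, k⁆ * g⁻¹) := by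
              simp [commutatorElement_def, mul_assoc]
            show ⁅x, g * k⁆ ∈ H
            rw [this]
            exact H.mul_mem hg (conj _ (c01 x hx k) hk g)
          inv_mem' := by
            intro g hg
            have : ⁅x, g⁻¹⁆ = (g⁻¹ * ⁅x, g⁆⁻¹ * g⁻¹⁻¹) := by
              simp [commutatorElement_def, mul_assoc]
            show ⁅x, g⁻¹⁆ ∈ H
            rw [this]
            exact conj _ (g1.inv_mem (c01 x hx g)) (H.inv_mem hg) _ }
      have hP : (⊤ : Subgroup G) ≤ P := by
        rw [← hT, closure_le]
        exact fun t ht => s1 t ht x hx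
      exact fun g => hP (mem_top g)
    exact commutator_le.2 fun x hx g _ => s2 x hx g

theorem four_prod {G : Type*} [Group G] (a a' b b' w w' c : G) (hc : ∀ g, Commute c g)
    (hw : ∀ g, Commute w g) (hw' : ∀ g, Commute w' g) (ha : a * a' = w) (hb : b * b' = w')
    (h : a * b = c * (b * a)) (k : ℕ) :
    a ^ k * b ^ k * a' ^ k * b' ^ k = (c ^ k * (w * w')) ^ k := by
  have ea : a ^ k * a' ^ k = w ^ k := by
    have : Commute a a' := by
      have : a' = a⁻¹ * w := by rw [← ha]; group
      rw [this]
      exact (Commute.refl a).inv_right.mul_right (hw a).symm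
    rw [← this.mul_pow, ha]
  have eb : b ^ k * b' ^ k = w' ^ k := by
    have : Commute b b' := by
      have : b' = b⁻¹ * w' := by rw [← hb]; group
      rw [this]
      exact (Commute.refl b).inv_right.mul_right (hw' b).symm
    rw [← this.mul_pow, hb]
  rw [comm_pow a b c hc h k k, ((hc _).pow_left k).mul_pow, (hw w').mul_pow, ← eb, ← pow_mul]
  calc _ = c ^ (k * k) * (b ^ k * (a ^ k * a' ^ k) * b' ^ k) := by group
    _ = _ := by rw [ea, ← ((hw (b ^ k)).pow_left k).eq]; simp only [mul_assoc]

theorem core {G : Type*} [Group G] (M : Submonoid G) (X : Set G) (K : Subgroup G)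
    (hZc : closure X ≤ center G) [hfg : Group.FG (closure X)]
    (hK : (K : Set G) = (M : Set G) * (closure X : Set G)) (hKf : K.FiniteIndex)
    (hX : ∀ z ∈ X, ∃ x g : G, ⁅x, g⁆ = z) :
    ∃ L : Subgroup G, (L : Set G) = (M : Set G) ∧ L.FiniteIndex := by
  set Z := closure X with hZ
  have hcen : ∀ z ∈ Z, ∀ g, Commute z g := fun z hz g => (mem_center_iff.1 (hZc hz) g).symm
  have hMK : ∀ m ∈ M, m ∈ K := by
    intro m hm
    have : m ∈ (K : Set G) := by
      rw [hK]; exact ⟨m, hm, 1, Z.one_mem, mul_one m⟩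
    exact this
  have hZK : Z ≤ K := by
    intro m hm
    have : m ∈ (K : Set G) := by
      rw [hK]; exact ⟨1, M.one_mem, m, hm, one_mul m⟩
    exact this
  have hKM : ∀ g ∈ K, ∃ m ∈ M, ∃ z ∈ Z, m * z = g := by
    intro g hg
    have : g ∈ (K : Set G) := hg
    rw [hK] at this
    exact this
  have hinv : ∀ a ∈ M, ∃ a' ∈ M, a * a' ∈ Z := by
    intro a ha
    obtain ⟨a', ha', z, hz, e⟩ := hKM _ (K.inv_mem (hMK a ha))
    refine ⟨a', ha', ?_⟩
    have : a' = a⁻¹ * z⁻¹ := by rw [← e]; group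
    rw [this]
    simpa using hz
  let : CommGroup Z :=
    { (inferInstance : Group Z) with
      mul_comm := fun a b => Subtype.ext (hcen a a.2 b).eq }
  let S : Submonoid Z := M.comap Z.subtype
  have hS : ∀ z : Z, z ∈ S ↔ (z : G) ∈ M := fun _ => Iff.rfl
  have key : ∀ z : Z, ∃ m : ℕ, 0 < m ∧ z ^ m ∈ S := by
    have : Group.FG Z := hfg
    apply comm_part S (((↑) : Z → G) ⁻¹' X) (closure_closure_coe_preimage)
    rintro ⟨z, hzZ⟩ (hz : z ∈ X)
    obtain ⟨x, g, hxg⟩ := hX z hz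
    obtain ⟨p, hp, _, hxp⟩ := exists_pow_mem_of_index_ne_zero hKf.index_ne_zero x
    obtain ⟨q, hq, _, hgq⟩ := exists_pow_mem_of_index_ne_zero hKf.index_ne_zero g
    obtain ⟨a, ha, z1, hz1, ea⟩ := hKM _ hxp
    obtain ⟨b, hb, z2, hz2, eb⟩ := hKM _ hgq
    obtain ⟨a', ha', hw⟩ := hinv a ha
    obtain ⟨b', hb', hw'⟩ := hinv b hb
    have hab : a * b = z ^ (p * q) * (b * a) := by
      have h0 : x * g = z * (g * x) := by rw [← hxg, commutatorElement_def]; group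
      have h1 := comm_pow x g z (hcen z hzZ) h0 p q
      rw [← ea, ← eb] at h1
      have e1 : a * z1 * (b * z2) = a * b * (z1 * z2) := by
        rw [mul_assoc, ← mul_assoc z1, (hcen z1 hz1 b).eq]; simp only [mul_assoc]
      have e2 : b * z2 * (a * z1) = b * a * (z1 * z2) := by
        rw [mul_assoc, ← mul_assoc z2, (hcen z2 hz2 a).eq, (hcen z1 hz1 z2).eq]
        simp only [mul_assoc]
      rw [e1, e2, ← mul_assoc (z ^ (p * q))] at h1
      exact mul_right_cancel h1
    have hc : z ^ (p * q) ∈ Z := Z.pow_mem hzZ _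
    have hba : b * a = (z ^ (p * q))⁻¹ * (a * b) := by rw [hab]; group
    refine ⟨⟨(a * a') * (b * b'), Z.mul_mem hw hw'⟩, M.mul_mem (M.mul_mem ha ha')
      (M.mul_mem hb hb'), p * q, by positivity, ?_⟩
    have P1 : ∀ k : ℕ, ((z ^ (p * q)) ^ k * ((a * a') * (b * b'))) ^ k ∈ M := by
      intro k
      rw [← four_prod a a' b b' _ _ _ (hcen _ hc) (hcen _ hw) (hcen _ hw') rfl rfl hab k]
      exact M.mul_mem (M.mul_mem (M.mul_mem (M.pow_mem ha k) (M.pow_mem hb k))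
        (M.pow_mem ha' k)) (M.pow_mem hb' k)
    have P2 : ∀ k : ℕ, (((z ^ (p * q))⁻¹) ^ k * ((a * a') * (b * b'))) ^ k ∈ M := by
      intro k
      rw [(hcen _ hw (b * b')).eq, ← four_prod b b' a a' _ _ _ (hcen _ (Z.inv_mem hc))
        (hcen _ hw') (hcen _ hw) rfl rfl hba k]
      exact M.mul_mem (M.mul_mem (M.mul_mem (M.pow_mem hb k) (M.pow_mem ha k))
        (M.pow_mem hb' k)) (M.pow_mem ha' k)
    intro k
    rcases lt_trichotomy k 0 with hk | rfl | hk
    · refine ⟨k.natAbs, by omega, ?_⟩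
      obtain ⟨j, rfl⟩ : ∃ j : ℕ, k = -j := ⟨k.natAbs, by omega⟩
      have := P2 j
      rw [hS]
      simpa using this
    · refine ⟨1, one_pos, ?_⟩
      rw [hS]
      simpa using M.mul_mem (M.mul_mem ha ha') (M.mul_mem hb hb')
    · refine ⟨k.natAbs, by omega, ?_⟩
      obtain ⟨j, rfl⟩ : ∃ j : ℕ, k = j := ⟨k.natAbs, by omega⟩
      have := P1 j
      rw [hS]
      simpa using this
  have hZinv : ∀ z ∈ Z, z ∈ M → z⁻¹ ∈ M := by
    intro z hz hzM
    obtain ⟨m, hm, h⟩ := key ⟨z⁻¹, Z.inv_mem hz⟩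
    have h' : (z⁻¹) ^ m ∈ M := h
    obtain ⟨m, rfl⟩ : ∃ j, m = j + 1 := ⟨m - 1, by omega⟩
    have := M.mul_mem (M.pow_mem hzM m) h'
    rwa [inv_pow, pow_succ', mul_inv_rev, ← mul_assoc, mul_inv_cancel, one_mul] at this
  let L : Subgroup G :=
    { M with
      inv_mem' := by
        intro a ha
        obtain ⟨a', ha', hw⟩ := hinv a ha
        have := M.mul_mem ha' (hZinv _ hw (M.mul_mem ha ha'))
        simpa using this }
  have hL : ∀ g, g ∈ L ↔ g ∈ M := fun _ => Iff.rfl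
  refine ⟨L, rfl, ?_⟩
  have hLK : L ≤ K := hMK
  have hfin : (L.subgroupOf Z).FiniteIndex := by
    have : Group.FG Z := hfg
    exact finite_part (L.subgroupOf Z) key
  have hfq : Finite (Z ⧸ L.subgroupOf Z) := finite_quotient_of_finiteIndex
  have hsurj : Function.Surjective (quotientSubgroupOfEmbeddingOfLE L hZK) := by
    intro y
    obtain ⟨⟨k, hk⟩, rfl⟩ := QuotientGroup.mk_surjective y
    obtain ⟨m, hm, z, hz, rfl⟩ := hKM k hk
    refine ⟨QuotientGroup.mk ⟨z, hz⟩, ?_⟩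
    refine QuotientGroup.eq.2 ?_
    rw [mem_subgroupOf, hL]
    have : z⁻¹ * (m * z) = m := by rw [← (hcen z hz m).eq]; group
    simpa [this] using hm
  have : Finite (K ⧸ L.subgroupOf K) := Finite.of_surjective _ hsurj
  have hi : (L.subgroupOf K).index ≠ 0 := (finiteIndex_of_finite_quotient).index_ne_zero
  refine ⟨?_⟩
  rw [← relIndex_mul_index hLK]
  exact mul_ne_zero hi hKf.index_ne_zero

theorem core' {G : Type*} [Group G] (M : Submonoid G) (X : Set G) (Z K : Subgroup G)
    (hZ : Z = closure X)
    (hZc : Z ≤ center G) [hfg : Group.FG Z]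
    (hK : (K : Set G) = (M : Set G) * (Z : Set G)) (hKf : K.FiniteIndex)
    (hX : ∀ z ∈ X, ∃ x g : G, ⁅x, g⁆ = z) :
    ∃ L : Subgroup G, (L : Set G) = (M : Set G) ∧ L.FiniteIndex := by
  subst hZ
  exact core M X K hZc hK hKf hX

theorem main_ind (n : ℕ) : ∀ {G : Type*} [Group G] [Group.FG G]
    (_ : (⊤ : Subgroup G).lowerCentralSeries (n + 1) = ⊥) (M : Submonoid G)
    (_ : ∃ H : Subgroup G,
      (H : Set G) = (M : Set G) * ((commutator G : Subgroup G) : Set G) ∧ H.FiniteIndex),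
    ∃ K : Subgroup G, (K : Set G) = (M : Set G) ∧ K.FiniteIndex := by
  induction n with
  | zero =>
    rintro G _ _ hn M ⟨H, hH, hf⟩
    have h1 : commutator G = ⊥ := hn
    rw [h1] at hH
    exact ⟨H, by simpa using hH, hf⟩
  | succ n ih =>
    rintro G _ _ hn M ⟨H, hH, hf⟩
    set Z := (⊤ : Subgroup G).lowerCentralSeries (n + 1) with hZ
    let f := QuotientGroup.mk' Z
    have hfs : Function.Surjective f := QuotientGroup.mk'_surjective Z
    have hq : (⊤ : Subgroup (G ⧸ Z)).lowerCentralSeries (n + 1) = ⊥ := by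
      rw [← map_top_of_surjective f hfs, ← map_lowerCentralSeries, ← hZ]
      exact QuotientGroup.map_mk'_self Z
    have hcm : commutator (G ⧸ Z) = (commutator G).map f := by
      rw [commutator_def, commutator_def, map_commutator, map_top_of_surjective f hfs]
    obtain ⟨K', hK', hK'f⟩ := ih hq (M.map f) ⟨H.map f, by
      rw [hcm, coe_map, hH, Set.image_mul]; rfl,
      ⟨ne_zero_of_dvd_ne_zero hf.index_ne_zero (index_map_dvd H hfs)⟩⟩
    obtain ⟨F, hF, hFs, hFc⟩ := lcs_fg (G := G) (n + 1)
    rw [hn, sup_bot_eq] at hFc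
    have hZfg : Z.FG := (Subgroup.fg_iff Z).2
      ⟨F, le_antisymm ((closure_le _).2 hFs) hFc, hF⟩
    have hcenter : Z ≤ center G := by
      intro z hz
      rw [mem_center_iff]
      intro g
      have : ⁅z, g⁆ ∈ (⊤ : Subgroup G).lowerCentralSeries (n + 1 + 1) :=
        commutator_mem_commutator hz (mem_top g)
      rw [hn, mem_bot, commutatorElement_eq_one_iff_mul_comm] at this
      exact this.symm
    have hZX : Z = closure {x | ∃ p ∈ (⊤ : Subgroup G).lowerCentralSeries n,
      ∃ q ∈ (⊤ : Subgroup G), ⁅p, q⁆ = x} := rfl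
    have hKset : ((K'.comap f : Subgroup G) : Set G) = (M : Set G) * (Z : Set G) := by
      rw [coe_comap, hK']
      ext g
      constructor
      · rintro ⟨m, hm, e⟩
        exact ⟨m, hm, m⁻¹ * g, QuotientGroup.eq.1 e, by group⟩
      · rintro ⟨m, hm, z, hz, rfl⟩
        refine ⟨m, hm, ?_⟩
        exact QuotientGroup.eq.2 (by simpa using hz)
    have hKfi : (K'.comap f).FiniteIndex :=
      ⟨by rw [index_comap_of_surjective _ hfs]; exact hK'f.index_ne_zero⟩
    have : Group.FG Z := (Group.fg_iff_subgroup_fg Z).2 hZfg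
    exact core' M _ Z _ hZX hcenter hKset hKfi (fun z ⟨p, _, q, _, e⟩ => ⟨p, q, e⟩)

theorem stmt_11 {G : Type*} [Group G] [Group.FG G] [Group.IsNilpotent G]
    (M : Submonoid G)
    (h : ∃ H : Subgroup G,
      (H : Set G) = (M : Set G) * ((commutator G : Subgroup G) : Set G) ∧
      H.FiniteIndex) :
    ∃ K : Subgroup G, (K : Set G) = (M : Set G) ∧ K.FiniteIndex := by
  obtain ⟨n, hn⟩ := Subgroup.nilpotent_iff_lowerCentralSeries.1 (inferInstance : Group.IsNilpotent G)
  exact main_ind n (eq_bot_iff.2 (hn ▸ Subgroup.lowerCentralSeries_antitone _ (Nat.le_succ n))) M h
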